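/- arXiv:1311.2298 — 2 statements merged into one kernel-verified Lean document; each statement's English description precedes it below -/
import Mathlib

section
/- If 𝒜 ⊆ 𝒫(n) is a union-closed family with |𝒜| ≥ (2/3 − 1/104)·2^n and 𝒜 ≠ {∅}, then there exists i ∈ [n] such that |{A ∈ 𝒜 : i ∈ A}| ≥ |𝒜|/2. -/
open Finset
open scoped Classical

/-- The total size `‖𝒜‖ = Σ_{A∈𝒜} |A|` of a family of finite sets. -/
def totalSize (𝒜 : Finset (Finset ℕ)) : ℕ := ∑ A ∈ 𝒜, A.card

/-- A family is union-closed if it is closed under pairwise unions. -/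
def UnionClosed (𝒜 : Finset (Finset ℕ)) : Prop := ∀ A ∈ 𝒜, ∀ B ∈ 𝒜, A ∪ B ∈ 𝒜

/-- The `k`-th finite set of positive integers in the colex order: the positive
integer `i` belongs to it iff bit `i - 1` of `k` is set. -/
def colexSet (k : ℕ) : Finset ℕ :=
  ((Finset.range (k + 1)).filter fun i => k.testBit i).image (· + 1)

/-- The initial segment `I(m)` of length `m` of the colex order on finite sets
of positive integers. -/
def colexInit (m : ℕ) : Finset (Finset ℕ) := (Finset.range m).image colexSet

/-- A family `ℬ` is simply rooted if every nonempty `B ∈ ℬ` has some `b ∈ B`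
with the whole cube `[{b}, B]` contained in `ℬ`. -/
def SimplyRooted (ℬ : Finset (Finset ℕ)) : Prop :=
  ∀ B ∈ ℬ, B.Nonempty → ∃ b ∈ B, ∀ C : Finset ℕ, {b} ⊆ C → C ⊆ B → C ∈ ℬ

/-- `B` is `ℬ`-rooted at `i`: `i ∈ B` and the cube `[{i}, B]` lies in `ℬ`. -/
def RootedAt (ℬ : Finset (Finset ℕ)) (B : Finset ℕ) (i : ℕ) : Prop :=
  i ∈ B ∧ ∀ C : Finset ℕ, {i} ⊆ C → C ⊆ B → C ∈ ℬ

/-- `ℬ_S`: the sets of `ℬ` that are `ℬ`-rooted at some element of `S`. -/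
noncomputable def rootedFam (ℬ : Finset (Finset ℕ)) (S : Finset ℕ) : Finset (Finset ℕ) :=
  ℬ.filter fun B => ∃ i ∈ S, RootedAt ℬ B i

/-- The image of a single set `B` under the down-compression of `ℬ` in
direction `i`. -/
def compressSet (ℬ : Finset (Finset ℕ)) (i : ℕ) (B : Finset ℕ) : Finset ℕ :=
  if i ∈ B ∧ B.erase i ∉ ℬ then B.erase i else B

/-- The down-compression `d_i(ℬ)` of the family `ℬ` in direction `i`. -/
def dComp (i : ℕ) (ℬ : Finset (Finset ℕ)) : Finset (Finset ℕ) :=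
  ℬ.image (compressSet ℬ i)

/-- `D_k(ℬ) = d_k(⋯ d_1(ℬ) ⋯)`.  In particular `d(ℬ) = D_n(ℬ)` for
`ℬ ⊆ 𝒫(n)`. -/
def DComp : ℕ → Finset (Finset ℕ) → Finset (Finset ℕ)
  | 0, ℬ => ℬ
  | k + 1, ℬ => dComp (k + 1) (DComp k ℬ)

/-- `D_{(ℬ,k)}(B)`: the image of the set `B` obtained by following `B` through
the successive compressions `d_1, …, d_k`.  In particular `d_ℬ(B) = D_{(ℬ,n)}(B)`
for `ℬ ⊆ 𝒫(n)`. -/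
def DCompSet : ℕ → Finset (Finset ℕ) → Finset ℕ → Finset ℕ
  | 0, _, B => B
  | k + 1, ℬ, B => compressSet (DComp k ℬ) (k + 1) (DCompSet k ℬ B)

/-- The shadow `δB = {B \ {i} : i ∈ B}` of a finite set `B`. -/
def shadowSet (B : Finset ℕ) : Finset (Finset ℕ) := B.image fun i => B.erase i

/-- `B` is a bad set of `ℬ ⊆ 𝒫(n)` if `δB ⊆ ℬ` or `d_ℬ(B) = B`. -/
def BadSet (n : ℕ) (ℬ : Finset (Finset ℕ)) (B : Finset ℕ) : Prop :=
  shadowSet B ⊆ ℬ ∨ DCompSet n ℬ B = B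

/-- A family is a down-set if it is closed under taking subsets. -/
def IsDownSet (𝒟 : Finset (Finset ℕ)) : Prop := ∀ A ∈ 𝒟, ∀ B ⊆ A, B ∈ 𝒟

/-- The deficiency `def(ℬ) = Σ_{B∈ℬ} |δB \ ℬ|`. -/
def deficiency (ℬ : Finset (Finset ℕ)) : ℕ := ∑ B ∈ ℬ, (shadowSet B \ ℬ).card

/-- `𝒜 ⊆ 𝒫(n)` is a counterexample to the union-closed conjecture:
union-closed, not `{∅}`, and every element of `[n]` has degree `< |𝒜|/2`. -/
def UCCounterexample (n : ℕ) (𝒜 : Finset (Finset ℕ)) : Prop :=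
  𝒜 ⊆ (Finset.Icc 1 n).powerset ∧ UnionClosed 𝒜 ∧ 𝒜 ≠ {∅} ∧
    ∀ i ∈ Finset.Icc 1 n, ((𝒜.filter fun A => i ∈ A).card : ℚ) < (𝒜.card : ℚ) / 2

/-- The average of `f` over the subsets of `s`. -/
def cubeAvg (s : Finset ℕ) (f : Finset ℕ → ℚ) : ℚ := (∑ T ∈ s.powerset, f T) / 2 ^ s.card

/-- The discrete derivative of `f` in direction `i`. -/
def cubeDeriv (i : ℕ) (f : Finset ℕ → ℚ) (T : Finset ℕ) : ℚ :=
  (f (T.erase i) - f (insert i T)) / 2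

theorem cubeAvg_insert {a : ℕ} {s : Finset ℕ} (ha : a ∉ s) (f : Finset ℕ → ℚ) :
    cubeAvg (insert a s) f = cubeAvg s fun T => (f T + f (insert a T)) / 2 := by
  unfold cubeAvg
  rw [sum_powerset_insert ha, card_insert_of_notMem ha, ← sum_add_distrib, ← sum_div, pow_succ]
  field_simp

theorem cubeAvg_congr {s : Finset ℕ} {f g : Finset ℕ → ℚ} (h : ∀ T ⊆ s, f T = g T) :
    cubeAvg s f = cubeAvg s g := by
  unfold cubeAvg
  rw [sum_congr rfl fun T hT => h T (mem_powerset.1 hT)]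

theorem cubeAvg_mono {s : Finset ℕ} {f g : Finset ℕ → ℚ} (h : ∀ T ⊆ s, f T ≤ g T) :
    cubeAvg s f ≤ cubeAvg s g := by
  unfold cubeAvg
  gcongr with T hT
  exact h T (mem_powerset.1 hT)

theorem cubeAvg_add (s : Finset ℕ) (f g : Finset ℕ → ℚ) :
    cubeAvg s (fun T => f T + g T) = cubeAvg s f + cubeAvg s g := by
  simp only [cubeAvg, sum_add_distrib, add_div]

theorem cubeAvg_mul_left (s : Finset ℕ) (c : ℚ) (f : Finset ℕ → ℚ) :
    cubeAvg s (fun T => c * f T) = c * cubeAvg s f := by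
  simp only [cubeAvg, ← mul_sum, mul_div_assoc]

theorem cubeAvg_const (s : Finset ℕ) (c : ℚ) : cubeAvg s (fun _ => c) = c := by
  simp [cubeAvg]

theorem cubeAvg_sum (s t : Finset ℕ) (f : ℕ → Finset ℕ → ℚ) :
    cubeAvg s (fun T => ∑ i ∈ t, f i T) = ∑ i ∈ t, cubeAvg s (f i) := by
  simp only [cubeAvg, ← sum_div]
  rw [sum_comm]

/-- The even part of `f` in direction `a`. -/
def evenPart (a : ℕ) (f : Finset ℕ → ℚ) (T : Finset ℕ) : ℚ := (f T + f (insert a T)) / 2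

/-- The odd part of `f` in direction `a`. -/
def oddPart (a : ℕ) (f : Finset ℕ → ℚ) (T : Finset ℕ) : ℚ := (f T - f (insert a T)) / 2

theorem cubeAvg_insert_sq {a : ℕ} {s : Finset ℕ} (ha : a ∉ s) (f : Finset ℕ → ℚ) :
    cubeAvg (insert a s) (fun T => f T ^ 2) =
      cubeAvg s (fun T => evenPart a f T ^ 2) + cubeAvg s (fun T => oddPart a f T ^ 2) := by
  rw [cubeAvg_insert ha, ← cubeAvg_add]
  refine cubeAvg_congr fun T _ => ?_
  unfold evenPart oddPart
  ring

theorem evenPart_cubeDeriv {a i : ℕ} (h : i ≠ a) (f : Finset ℕ → ℚ) (T : Finset ℕ) :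
    evenPart a (cubeDeriv i f) T = cubeDeriv i (evenPart a f) T := by
  simp only [evenPart, cubeDeriv]
  rw [erase_insert_of_ne h.symm, insert_comm i a]
  ring

theorem oddPart_cubeDeriv {a i : ℕ} (h : i ≠ a) (f : Finset ℕ → ℚ) (T : Finset ℕ) :
    oddPart a (cubeDeriv i f) T = cubeDeriv i (oddPart a f) T := by
  simp only [oddPart, cubeDeriv]
  rw [erase_insert_of_ne h.symm, insert_comm i a]
  ring

theorem cubeAvg_insert_cubeDeriv {a : ℕ} {s : Finset ℕ} (ha : a ∉ s) (f : Finset ℕ → ℚ) :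
    cubeAvg (insert a s) (cubeDeriv a f) = cubeAvg s (oddPart a f) := by
  rw [cubeAvg_insert ha]
  refine cubeAvg_congr fun T hT => ?_
  have haT : a ∉ T := fun h => ha (hT h)
  simp only [cubeDeriv, oddPart, erase_insert haT, erase_eq_of_notMem haT, insert_idem]
  ring

theorem cubeAvg_insert_cubeDeriv_sq {a : ℕ} {s : Finset ℕ} (ha : a ∉ s) (f : Finset ℕ → ℚ) :
    cubeAvg (insert a s) (fun T => cubeDeriv a f T ^ 2) =
      cubeAvg s (fun T => oddPart a f T ^ 2) := by
  rw [cubeAvg_insert ha]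
  refine cubeAvg_congr fun T hT => ?_
  have haT : a ∉ T := fun h => ha (hT h)
  simp only [cubeDeriv, oddPart, erase_insert haT, erase_eq_of_notMem haT, insert_idem]
  ring

/-- The total influence of `f` on the cube of subsets of `s`. -/
def totalInfluence (s : Finset ℕ) (f : Finset ℕ → ℚ) : ℚ :=
  ∑ i ∈ s, cubeAvg s fun T => cubeDeriv i f T ^ 2

/-- The variance of `f` on the cube of subsets of `s`. -/
def cubeVar (s : Finset ℕ) (f : Finset ℕ → ℚ) : ℚ :=
  cubeAvg s (fun T => f T ^ 2) - cubeAvg s f ^ 2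

theorem totalInfluence_insert {a : ℕ} {s : Finset ℕ} (ha : a ∉ s) (f : Finset ℕ → ℚ) :
    totalInfluence (insert a s) f = totalInfluence s (evenPart a f) +
      totalInfluence s (oddPart a f) + cubeAvg s (fun T => oddPart a f T ^ 2) := by
  unfold totalInfluence
  rw [sum_insert ha, cubeAvg_insert_cubeDeriv_sq ha, ← sum_add_distrib, add_comm]
  congr 1
  refine sum_congr rfl fun i hi => ?_
  have hia : i ≠ a := fun h => ha (h ▸ hi)
  rw [cubeAvg_insert_sq ha]
  simp only [evenPart_cubeDeriv hia, oddPart_cubeDeriv hia]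

theorem cubeVar_insert {a : ℕ} {s : Finset ℕ} (ha : a ∉ s) (f : Finset ℕ → ℚ) :
    cubeVar (insert a s) f =
      cubeVar s (evenPart a f) + cubeAvg s (fun T => oddPart a f T ^ 2) := by
  unfold cubeVar
  rw [cubeAvg_insert_sq ha, cubeAvg_insert ha]
  change _ - cubeAvg s (evenPart a f) ^ 2 = _
  ring

/-- The Poincaré inequality on the discrete cube. -/
theorem cubeVar_le_totalInfluence (s : Finset ℕ) (f : Finset ℕ → ℚ) :
    cubeVar s f ≤ totalInfluence s f := by
  induction s using Finset.induction_on generalizing f with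
  | empty => simp [cubeVar, totalInfluence, cubeAvg]
  | insert a s ha ih =>
    rw [cubeVar_insert ha, totalInfluence_insert ha]
    have hodd : 0 ≤ totalInfluence s (oddPart a f) :=
      sum_nonneg fun i _ => div_nonneg (sum_nonneg fun T _ => sq_nonneg _) (by positivity)
    linarith [ih (evenPart a f)]

/-- The Poincaré inequality sharpened by the degree-one Fourier weight. -/
theorem two_mul_cubeVar_le (s : Finset ℕ) (f : Finset ℕ → ℚ) :
    2 * cubeVar s f ≤ totalInfluence s f + ∑ i ∈ s, cubeAvg s (cubeDeriv i f) ^ 2 := by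
  induction s using Finset.induction_on generalizing f with
  | empty => simp [cubeVar, totalInfluence, cubeAvg]
  | insert a s ha ih =>
    have hcoef : ∀ i ∈ s, cubeAvg (insert a s) (cubeDeriv i f) ^ 2 =
        cubeAvg s (cubeDeriv i (evenPart a f)) ^ 2 := by
      intro i hi
      have hia : i ≠ a := fun h => ha (h ▸ hi)
      rw [cubeAvg_insert ha]
      congr 1
      exact cubeAvg_congr fun T _ => evenPart_cubeDeriv hia f T
    rw [cubeVar_insert ha, totalInfluence_insert ha, sum_insert ha, sum_congr rfl hcoef,
      cubeAvg_insert_cubeDeriv ha]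
    have hodd := cubeVar_le_totalInfluence s (oddPart a f)
    unfold cubeVar at hodd
    linarith [ih (evenPart a f)]

theorem cubeAvg_eq_two_mul {s : Finset ℕ} {i : ℕ} (hi : i ∈ s) {h : Finset ℕ → ℚ}
    (hh : ∀ T, i ∉ T → h T = h (insert i T)) :
    cubeAvg s h = 2 * cubeAvg s fun B => if i ∈ B then h B else 0 := by
  rw [← insert_erase hi, cubeAvg_insert (notMem_erase i s), cubeAvg_insert (notMem_erase i s),
    ← cubeAvg_mul_left]
  refine cubeAvg_congr fun T hT => ?_
  have hiT : i ∉ T := fun h => notMem_erase i s (hT h)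
  simp only [hiT, hh T hiT, mem_insert_self, if_true, if_false]
  ring

theorem cubeAvg_cubeDeriv_indicator {s : Finset ℕ} {i : ℕ} (hi : i ∈ s)
    {𝒜 : Finset (Finset ℕ)} (hsub : 𝒜 ⊆ s.powerset) :
    cubeAvg s (cubeDeriv i fun T => if T ∈ 𝒜 then 1 else 0) =
      ((𝒜.card : ℚ) - 2 * (𝒜.filter fun A => i ∈ A).card) / 2 ^ s.card := by
  have h1 : (𝒜.card : ℚ) / 2 ^ s.card = cubeAvg s fun T => if T ∈ 𝒜 then 1 else 0 := by
    rw [cubeAvg, sum_boole, filter_mem_eq_inter, inter_eq_right.2 hsub]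
  have h2 : ((𝒜.filter fun A => i ∈ A).card : ℚ) / 2 ^ s.card =
      cubeAvg s fun T => if T ∈ 𝒜 ∧ i ∈ T then 1 else 0 := by
    rw [cubeAvg, sum_boole]
    congr 3
    ext T
    have := @hsub T
    simp only [mem_filter]
    tauto
  rw [sub_div, mul_div_assoc, h1, h2, sub_eq_add_neg, ← neg_one_mul, ← cubeAvg_mul_left,
    ← cubeAvg_mul_left, ← cubeAvg_add, ← insert_erase hi, cubeAvg_insert (notMem_erase i s),
    cubeAvg_insert (notMem_erase i s)]
  refine cubeAvg_congr fun T hT => ?_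
  have hiT : i ∉ T := fun h => notMem_erase i s (hT h)
  simp only [cubeDeriv, erase_insert hiT, erase_eq_of_notMem hiT, insert_idem, hiT, and_false,
    mem_insert_self, and_true, if_false]
  ring

/-- In a union-closed family, a missing set covers at most one member. -/
theorem UnionClosed.card_filter_erase_mem_le_one {𝒜 : Finset (Finset ℕ)} (huc : UnionClosed 𝒜)
    {B : Finset ℕ} (hB : B ∉ 𝒜) : (B.filter fun i => B.erase i ∈ 𝒜).card ≤ 1 := by
  refine card_le_one.2 fun i hi j hj => ?_
  by_contra hij
  rw [mem_filter] at hi hj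
  refine hB ?_
  have hu := huc _ hi.2 _ hj.2
  have hunion : B.erase i ∪ B.erase j = B := by
    ext x
    simp only [mem_union, mem_erase]
    grind
  rwa [hunion] at hu

theorem UnionClosed.sum_cubeAvg_cubeDeriv_le {𝒜 : Finset (Finset ℕ)} (huc : UnionClosed 𝒜)
    (s : Finset ℕ) :
    ∑ i ∈ s, (cubeAvg s (fun T => cubeDeriv i (fun T => if T ∈ 𝒜 then 1 else 0) T ^ 2) +
        1 / 2 * cubeAvg s (cubeDeriv i fun T => if T ∈ 𝒜 then 1 else 0)) ≤
      1 - cubeAvg s fun T => if T ∈ 𝒜 then 1 else 0 := by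
  have hterm : ∀ i ∈ s,
      cubeAvg s (fun T => cubeDeriv i (fun T => if T ∈ 𝒜 then 1 else 0) T ^ 2) +
        1 / 2 * cubeAvg s (cubeDeriv i fun T => if T ∈ 𝒜 then 1 else 0) =
      cubeAvg s fun B => if i ∈ B ∧ B ∉ 𝒜 ∧ B.erase i ∈ 𝒜 then 1 else 0 := by
    intro i hi
    rw [← cubeAvg_mul_left, ← cubeAvg_add, cubeAvg_eq_two_mul hi, ← cubeAvg_mul_left]
    · refine cubeAvg_congr fun T _ => ?_
      by_cases hiT : i ∈ T
      · by_cases h1 : T ∈ 𝒜 <;> by_cases h2 : T.erase i ∈ 𝒜 <;>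
          norm_num [cubeDeriv, hiT, h1, h2, insert_eq_of_mem hiT]
      · simp [hiT]
    · intro T hiT
      simp only [cubeDeriv, erase_insert hiT, erase_eq_of_notMem hiT, insert_idem]
  have hone : (1 : ℚ) - cubeAvg s (fun T => if T ∈ 𝒜 then 1 else 0) =
      cubeAvg s fun T => 1 + -1 * if T ∈ 𝒜 then 1 else 0 := by
    rw [cubeAvg_add, cubeAvg_mul_left, cubeAvg_const]
    ring
  rw [sum_congr rfl hterm, ← cubeAvg_sum, hone]
  refine cubeAvg_mono fun B hBs => ?_
  by_cases hB : B ∈ 𝒜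
  · simp [hB]
  · rw [sum_boole]
    have hle : (s.filter fun i => i ∈ B ∧ B ∉ 𝒜 ∧ B.erase i ∈ 𝒜).card ≤ 1 := by
      refine le_trans (card_le_card fun i hi => ?_) (huc.card_filter_erase_mem_le_one hB)
      simp only [mem_filter] at hi ⊢
      exact ⟨hi.2.1, hi.2.2.2⟩
    simpa [hB] using hle

/-- A union-closed family of density more than `1 / 2` in a nontrivial cube has an element
belonging to at least half of its members. -/
theorem UnionClosed.exists_half_le_degree {𝒜 : Finset (Finset ℕ)} (huc : UnionClosed 𝒜)
    {s : Finset ℕ} (hs : s.Nonempty) (hsub : 𝒜 ⊆ s.powerset)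
    (hcard : (2 : ℚ) ^ s.card / 2 < 𝒜.card) :
    ∃ i ∈ s, (𝒜.card : ℚ) / 2 ≤ (𝒜.filter fun A => i ∈ A).card := by
  by_contra! hlt
  set f : Finset ℕ → ℚ := fun T => if T ∈ 𝒜 then 1 else 0 with hf
  have hpos : ∀ i ∈ s, 0 < cubeAvg s (cubeDeriv i f) := by
    intro i hi
    rw [cubeAvg_cubeDeriv_indicator hi hsub]
    have := hlt i hi
    exact div_pos (by linarith) (by positivity)
  have hhalf : ∀ i ∈ s, cubeAvg s (cubeDeriv i f) ≤ 1 / 2 := by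
    intro i _
    rw [← cubeAvg_const s (1 / 2)]
    refine cubeAvg_mono fun T _ => ?_
    simp only [cubeDeriv, hf]
    split_ifs <;> norm_num
  have hsq : ∑ i ∈ s, cubeAvg s (cubeDeriv i f) ^ 2 ≤
      ∑ i ∈ s, 1 / 2 * cubeAvg s (cubeDeriv i f) := by
    refine sum_le_sum fun i hi => ?_
    nlinarith [hpos i hi, hhalf i hi]
  have hsum := huc.sum_cubeAvg_cubeDeriv_le s
  rw [sum_add_distrib] at hsum
  have hvar := two_mul_cubeVar_le s f
  have hff : cubeAvg s (fun T => f T ^ 2) = cubeAvg s f :=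
    cubeAvg_congr fun T _ => by simp [hf]
  have hdens : cubeAvg s f = (𝒜.card : ℚ) / 2 ^ s.card := by
    rw [cubeAvg, hf, sum_boole, filter_mem_eq_inter, inter_eq_right.2 hsub]
  have hp : 1 / 2 < cubeAvg s f := by
    rw [hdens, lt_div_iff₀ (by positivity)]
    linarith
  have hinfl : 0 ≤ totalInfluence s f :=
    sum_nonneg fun i _ => div_nonneg (sum_nonneg fun T _ => sq_nonneg _) (by positivity)
  have hlin : 0 < ∑ i ∈ s, 1 / 2 * cubeAvg s (cubeDeriv i f) :=
    sum_pos (fun i hi => mul_pos (by norm_num) (hpos i hi)) hs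
  unfold cubeVar at hvar
  rw [hff] at hvar
  unfold totalInfluence at hvar hinfl
  nlinarith

/-- The union-closed conjecture holds for union-closed families
`𝒜 ⊆ 𝒫(n)` with `|𝒜| ≥ (2/3 - 1/104)·2^n`. -/
theorem stmt3 (n : ℕ) (𝒜 : Finset (Finset ℕ)) (hsub : 𝒜 ⊆ (Finset.Icc 1 n).powerset)
    (huc : UnionClosed 𝒜) (hcard : (2 / 3 - 1 / 104 : ℚ) * 2 ^ n ≤ (𝒜.card : ℚ))
    (hne : 𝒜 ≠ {∅}) :
    ∃ i ∈ Finset.Icc 1 n,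
      (𝒜.card : ℚ) / 2 ≤ ((𝒜.filter fun A => i ∈ A).card : ℚ) := by
  have hlt : (2 : ℚ) ^ (Icc 1 n).card / 2 < 𝒜.card := by
    have : (0 : ℚ) < 2 ^ n := by positivity
    rw [Nat.card_Icc, Nat.add_sub_cancel]
    linarith
  rcases Nat.eq_zero_or_pos n with rfl | hn
  · refine absurd ((subset_singleton_iff.1 (by simpa using hsub)).resolve_left ?_) hne
    rintro rfl
    norm_num at hlt
  · exact huc.exists_half_le_degree (nonempty_Icc.2 hn) hsub hlt
end

section
/- Let m₁ and m₂ be positive integers. Then ‖I(m₁)‖ + ‖I(m₂)‖ ≤ ‖I(m₁+m₂)‖ − min(m₁, m₂). -/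
open Finset
open scoped Classical

lemma succ_mem_colexSet {k i : ℕ} : i + 1 ∈ colexSet k ↔ k.testBit i = true := by
  simp only [colexSet, mem_image, mem_filter, mem_range, Nat.add_right_cancel_iff,
    exists_eq_right, and_iff_right_iff_imp]
  intro h
  have := Nat.ge_two_pow_of_testBit h
  have := Nat.lt_two_pow_self (n := i)
  omega

lemma zero_notMem_colexSet (k : ℕ) : 0 ∉ colexSet k := by
  simp [colexSet]

lemma colexSet_injective : Function.Injective colexSet := by
  intro k l h
  refine Nat.eq_of_testBit_eq fun i => ?_
  rw [Bool.eq_iff_iff, ← succ_mem_colexSet, ← succ_mem_colexSet, h]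

lemma colexSet_two_mul (k : ℕ) : colexSet (2 * k) = (colexSet k).image (· + 1) := by
  ext j
  rcases j with _ | _ | j
  · simp [zero_notMem_colexSet]
  · simp [succ_mem_colexSet, zero_notMem_colexSet]
  · rw [succ_mem_colexSet, Nat.testBit_succ]
    simp [succ_mem_colexSet]

lemma colexSet_two_mul_add_one (k : ℕ) :
    colexSet (2 * k + 1) = insert 1 ((colexSet k).image (· + 1)) := by
  ext j
  rcases j with _ | _ | j
  · simp [zero_notMem_colexSet]
  · simp [succ_mem_colexSet]
  · rw [succ_mem_colexSet, Nat.testBit_succ, show (2 * k + 1) / 2 = k by omega]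
    simp [succ_mem_colexSet]

lemma card_colexSet_two_mul (k : ℕ) : (colexSet (2 * k)).card = (colexSet k).card := by
  rw [colexSet_two_mul, card_image_of_injective _ (add_left_injective 1)]

lemma card_colexSet_two_mul_add_one (k : ℕ) :
    (colexSet (2 * k + 1)).card = (colexSet k).card + 1 := by
  rw [colexSet_two_mul_add_one, card_insert_of_notMem,
    card_image_of_injective _ (add_left_injective 1)]
  simp [zero_notMem_colexSet]

lemma totalSize_colexInit (m : ℕ) :
    totalSize (colexInit m) = ∑ k ∈ range m, (colexSet k).card :=
  sum_image colexSet_injective.injOn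

lemma totalSize_colexInit_succ (m : ℕ) :
    totalSize (colexInit (m + 1)) = totalSize (colexInit m) + (colexSet m).card := by
  simp only [totalSize_colexInit, sum_range_succ]

lemma totalSize_colexInit_two_mul (m : ℕ) :
    totalSize (colexInit (2 * m)) = 2 * totalSize (colexInit m) + m := by
  induction m with
  | zero => simp [totalSize_colexInit]
  | succ m ih =>
    rw [show 2 * (m + 1) = 2 * m + 1 + 1 by ring, totalSize_colexInit_succ,
      totalSize_colexInit_succ, totalSize_colexInit_succ, ih, card_colexSet_two_mul,
      card_colexSet_two_mul_add_one]
    ring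

lemma totalSize_colexInit_two_mul_add_one (m : ℕ) :
    totalSize (colexInit (2 * m + 1)) =
      totalSize (colexInit m) + totalSize (colexInit (m + 1)) + m := by
  rw [totalSize_colexInit_succ, totalSize_colexInit_succ, totalSize_colexInit_two_mul,
    card_colexSet_two_mul]
  ring

lemma totalSize_colexInit_add_le (a b : ℕ) :
    totalSize (colexInit a) + totalSize (colexInit b) + min a b ≤
      totalSize (colexInit (a + b)) := by
  induction h : a + b using Nat.strong_induction_on generalizing a b with
  | _ n ih =>
    subst h
    rcases Nat.eq_zero_or_pos a with rfl | ha
    · simp [totalSize_colexInit]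
    rcases Nat.eq_zero_or_pos b with rfl | hb
    · simp [totalSize_colexInit]
    obtain ⟨x, rfl | rfl⟩ := Nat.even_or_odd' a <;> obtain ⟨y, rfl | rfl⟩ := Nat.even_or_odd' b
    · have h := ih (x + y) (by omega) x y rfl
      rw [← mul_add]
      simp only [totalSize_colexInit_two_mul]
      omega
    · have h := ih (x + y) (by omega) x y rfl
      have h' := ih (x + y + 1) (by omega) x (y + 1) rfl
      rw [← add_assoc, ← mul_add]
      simp only [totalSize_colexInit_two_mul, totalSize_colexInit_two_mul_add_one]
      omega
    · have h := ih (x + y) (by omega) x y rfl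
      have h' := ih (x + y + 1) (by omega) (x + 1) y (by ring)
      rw [show 2 * x + 1 + 2 * y = 2 * (x + y) + 1 by ring]
      simp only [totalSize_colexInit_two_mul, totalSize_colexInit_two_mul_add_one]
      omega
    · rcases Nat.eq_zero_or_pos (x + y) with h₀ | h₀
      · obtain ⟨rfl, rfl⟩ : x = 0 ∧ y = 0 := by omega
        rw [show 2 * 0 + 1 + (2 * 0 + 1) = 2 * 1 by rfl,
          totalSize_colexInit_two_mul]
        simp [totalSize_colexInit, colexSet]
      have h := ih (x + y + 1) (by omega) x (y + 1) rfl
      have h' := ih (x + y + 1) (by omega) (x + 1) y (by ring)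
      rw [show 2 * x + 1 + (2 * y + 1) = 2 * (x + y + 1) by ring]
      simp only [totalSize_colexInit_two_mul, totalSize_colexInit_two_mul_add_one]
      omega

/-- `‖I(m₁)‖ + ‖I(m₂)‖ ≤ ‖I(m₁+m₂)‖ - min(m₁, m₂)` for
positive integers `m₁, m₂`. -/
theorem stmt5 (m₁ m₂ : ℕ) (h₁ : 1 ≤ m₁) (h₂ : 1 ≤ m₂) :
    (totalSize (colexInit m₁) : ℤ) + (totalSize (colexInit m₂) : ℤ) ≤
      (totalSize (colexInit (m₁ + m₂)) : ℤ) - ((min m₁ m₂ : ℕ) : ℤ) := by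
  have := totalSize_colexInit_add_le m₁ m₂
  omega
end
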